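/- Let q ∈ (5/2, 10/3), c ∈ ((5−q)/(6q−5), 1/4), ρ > 0, u ∈ H^1(B_ρ; ℝ^5), and p ∈ L^{5(1+c)/(4−c)}(B_ρ). Then there is a constant N = N(c) > 0 such that ∫_{B_ρ} |p − (p)_{B_ρ}| |u| dx ≤ N ρ² [ A(ρ)^{(9c−1)/(4(1+c))} E(ρ)^{(3−7c)/(4(1+c))} G(ρ)^{(4−c)/(5(1+c))} + A(ρ)^{1/2} G(ρ)^{(4−c)/(5(1+c))} ], where A(ρ) = ρ^{−3}∫_{B_ρ}|u|² dx, E(ρ) = ρ^{−1}∫_{B_ρ}|∇u|² dx, and G(ρ) = ρ^{−(10−15c)/(4−c)}∫_{B_ρ}|p − (p)_{B_ρ}|^{5(1+c)/(4−c)} dx. -/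

import Mathlib

open MeasureTheory Metric Real NNReal

noncomputable section

/-- Five dimensional Euclidean space. -/
abbrev E5 := EuclideanSpace ℝ (Fin 5)

/-- Standard basis vector. -/
def eb (i : Fin 5) : E5 := EuclideanSpace.single i 1

/-- Euclidean inner product on `E5`. -/
def inner5 (a b : E5) : ℝ := ∑ i : Fin 5, a i * b i

/-- `|∇u|²`, the squared (Frobenius) norm of the gradient of a vector field. -/
def gradNormSq (u : E5 → E5) (x : E5) : ℝ :=
  ∑ i : Fin 5, ‖fderiv ℝ u x (eb i)‖ ^ 2

/-- Divergence of a vector field. -/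
def divg (u : E5 → E5) (x : E5) : ℝ :=
  ∑ i : Fin 5, fderiv ℝ u x (eb i) i

/-- Laplacian of a scalar function. -/
def lap (ψ : E5 → ℝ) (x : E5) : ℝ :=
  ∑ i : Fin 5, fderiv ℝ (fun y => fderiv ℝ ψ y (eb i)) x (eb i)

/-- The unit ball `B_1 ⊆ ℝ⁵`. -/
def B1 : Set E5 := ball 0 1

/-- The open upper half space `{x₅ > 0}`. -/
def upperHalf : Set E5 := {x : E5 | 0 < x 4}

/-- The unit upper half ball `B_1⁺`. -/
def B1p : Set E5 := B1 ∩ upperHalf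

/-- The upper half ball `B⁺(x₀, r)`. -/
def Bp (x0 : E5) (r : ℝ) : Set E5 := ball x0 r ∩ upperHalf

/-- Average of a function over a set (w.r.t. Lebesgue measure). -/
def avgOn (s : Set E5) (g : E5 → ℝ) : ℝ := ⨍ x in s, g x

/-- `(u, p)` is a suitable weak solution of the 5D stationary Navier-Stokes equations
`u·∇u − Δu + ∇p = f`, `div u = 0` in the unit ball `B_1`. -/
structure IsSWS (u : E5 → E5) (p : E5 → ℝ) (f : E5 → E5) : Prop where
  u_diff : ∀ x ∈ B1, DifferentiableAt ℝ u x
  u_L2 : IntegrableOn (fun x => ‖u x‖ ^ 2) B1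
  grad_L2 : IntegrableOn (gradNormSq u) B1
  p_L1 : IntegrableOn p B1
  div_free : ∀ x ∈ B1, divg u x = 0
  pde : ∀ φ : E5 → E5, ContDiff ℝ (⊤ : ℕ∞) φ → HasCompactSupport φ → tsupport φ ⊆ B1 →
    ∫ x in B1, (inner5 (fderiv ℝ u x (u x)) (φ x)
      + ∑ i : Fin 5, inner5 (fderiv ℝ u x (eb i)) (fderiv ℝ φ x (eb i))
      - p x * divg φ x - inner5 (f x) (φ x)) = 0
  energy : ∀ ψ : E5 → ℝ, ContDiff ℝ (⊤ : ℕ∞) ψ → (∀ x, 0 ≤ ψ x) →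
    HasCompactSupport ψ → tsupport ψ ⊆ B1 →
    2 * ∫ x in B1, gradNormSq u x * ψ x ≤
      ∫ x in B1, (‖u x‖ ^ 2 * lap ψ x
        + (‖u x‖ ^ 2 + 2 * p x) * inner5 (u x) (gradient ψ x)
        + 2 * inner5 (f x) (u x) * ψ x)

/-- `(u, p)` is a suitable weak solution of the 5D stationary Navier-Stokes equations in the
unit upper half ball `B_1⁺`, with zero Dirichlet condition on the flat boundary portion
`B_1 ∩ {x₅ = 0}`.  Test functions for the local energy inequality may be nonzero on the flat
boundary but vanish near the curved boundary. -/
structure IsSWSHalf (u : E5 → E5) (p : E5 → ℝ) (f : E5 → E5) : Prop where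
  u_diff : ∀ x ∈ B1p, DifferentiableAt ℝ u x
  u_L2 : IntegrableOn (fun x => ‖u x‖ ^ 2) B1p
  grad_L2 : IntegrableOn (gradNormSq u) B1p
  p_L1 : IntegrableOn p B1p
  bc : ∀ x : E5, ‖x‖ < 1 → x 4 = 0 → u x = 0
  div_free : ∀ x ∈ B1p, divg u x = 0
  pde : ∀ φ : E5 → E5, ContDiff ℝ (⊤ : ℕ∞) φ → HasCompactSupport φ → tsupport φ ⊆ B1p →
    ∫ x in B1p, (inner5 (fderiv ℝ u x (u x)) (φ x)
      + ∑ i : Fin 5, inner5 (fderiv ℝ u x (eb i)) (fderiv ℝ φ x (eb i))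
      - p x * divg φ x - inner5 (f x) (φ x)) = 0
  energy : ∀ ψ : E5 → ℝ, ContDiff ℝ (⊤ : ℕ∞) ψ → (∀ x, 0 ≤ ψ x) →
    HasCompactSupport ψ → tsupport ψ ⊆ B1 →
    2 * ∫ x in B1p, gradNormSq u x * ψ x ≤
      ∫ x in B1p, (‖u x‖ ^ 2 * lap ψ x
        + (‖u x‖ ^ 2 + 2 * p x) * inner5 (u x) (gradient ψ x)
        + 2 * inner5 (f x) (u x) * ψ x)

/-- `A(x₀,r) = r⁻³ ∫_{B(x₀,r)} |u|²`. -/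
def qA (u : E5 → E5) (x0 : E5) (r : ℝ) : ℝ := (∫ x in ball x0 r, ‖u x‖ ^ 2) / r ^ 3

/-- `C(x₀,r) = r^{q−5} ∫_{B(x₀,r)} |u|^q`. -/
def qC (u : E5 → E5) (q : ℝ) (x0 : E5) (r : ℝ) : ℝ :=
  (∫ x in ball x0 r, ‖u x‖ ^ q) / r ^ (5 - q)

/-- `E(x₀,r) = r⁻¹ ∫_{B(x₀,r)} |∇u|²`. -/
def qE (u : E5 → E5) (x0 : E5) (r : ℝ) : ℝ := (∫ x in ball x0 r, gradNormSq u x) / r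

/-- `G(x₀,r) = r^{−(10−15c)/(4−c)} ∫_{B(x₀,r)} |p − (p)_{B(x₀,r)}|^{5(1+c)/(4−c)}`. -/
def qG (p : E5 → ℝ) (c : ℝ) (x0 : E5) (r : ℝ) : ℝ :=
  (∫ x in ball x0 r, |p x - avgOn (ball x0 r) p| ^ (5 * (1 + c) / (4 - c))) /
    r ^ ((10 - 15 * c) / (4 - c))

/-- `P(x₀,r) = r⁻³ ∫_{B(x₀,r)} |p − (p)_{B(x₀,r)}|`. -/
def qP (p : E5 → ℝ) (x0 : E5) (r : ℝ) : ℝ :=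
  (∫ x in ball x0 r, |p x - avgOn (ball x0 r) p|) / r ^ 3

/-- `F(x₀,r) = r ∫_{B(x₀,r)} |f|²`. -/
def qF (f : E5 → E5) (x0 : E5) (r : ℝ) : ℝ := r * ∫ x in ball x0 r, ‖f x‖ ^ 2

/-- `A⁺(x₀,r)`. -/
def qAp (u : E5 → E5) (x0 : E5) (r : ℝ) : ℝ := (∫ x in Bp x0 r, ‖u x‖ ^ 2) / r ^ 3

/-- `C⁺(x₀,r)`. -/
def qCp (u : E5 → E5) (q : ℝ) (x0 : E5) (r : ℝ) : ℝ :=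
  (∫ x in Bp x0 r, ‖u x‖ ^ q) / r ^ (5 - q)

/-- `E⁺(x₀,r)`. -/
def qEp (u : E5 → E5) (x0 : E5) (r : ℝ) : ℝ := (∫ x in Bp x0 r, gradNormSq u x) / r

/-- `G⁺(x₀,r)`. -/
def qGp (p : E5 → ℝ) (c : ℝ) (x0 : E5) (r : ℝ) : ℝ :=
  (∫ x in Bp x0 r, |p x - avgOn (Bp x0 r) p| ^ (5 * (1 + c) / (4 - c))) /
    r ^ ((10 - 15 * c) / (4 - c))

/-- `P⁺(x₀,r)`. -/
def qPp (p : E5 → ℝ) (x0 : E5) (r : ℝ) : ℝ :=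
  (∫ x in Bp x0 r, |p x - avgOn (Bp x0 r) p|) / r ^ 3

/-- `F⁺(x₀,r)`. -/
def qFp (f : E5 → E5) (x0 : E5) (r : ℝ) : ℝ := r * ∫ x in Bp x0 r, ‖f x‖ ^ 2

/-- `u` agrees a.e. on `s` with a function that is Hölder continuous on `s`. -/
def HolderPiece (u : E5 → E5) (s : Set E5) : Prop :=
  ∃ (v : E5 → E5) (C α : ℝ≥0), 0 < α ∧ (α : ℝ) ≤ 1 ∧ HolderOnWith C α v s ∧
    (∀ᵐ x ∂(volume.restrict s), u x = v x)

section SegmentIntegral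

variable {E F : Type*} [NormedAddCommGroup E] [NormedSpace ℝ E]
  [NormedAddCommGroup F] [NormedSpace ℝ F] [CompleteSpace F] {Ω : Set E}

/-- A function differentiable along a segment is controlled by its value at the far end and the
integral of its derivative. -/
theorem enorm_le_add_lintegral_segment {u : E → F} (hc : Convex ℝ Ω)
    (hu : ∀ x ∈ Ω, DifferentiableAt ℝ u x) {x z : E} (hx : x ∈ Ω) (hz : z ∈ Ω) {δ : ℝ}
    (hδ : 0 ≤ δ) (hδ1 : δ ≤ 1) :
    ‖u x‖ₑ ≤ ‖u ((1 - δ) • x + δ • z)‖ₑ +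
      ‖z - x‖ₑ * ∫⁻ t in Set.Ioc 0 δ, ‖fderiv ℝ u ((1 - t) • x + t • z)‖ₑ := by
  set γ : ℝ → F := fun t => u ((1 - t) • x + t • z)
  set γ' : ℝ → F := fun t => fderiv ℝ u ((1 - t) • x + t • z) (z - x)
  have hderiv : ∀ t ∈ Set.uIcc 0 δ, HasDerivAt γ (γ' t) t := by
    intro t ht
    rw [Set.uIcc_of_le hδ] at ht
    have h1 : HasDerivAt (fun t : ℝ => (1 - t) • x + t • z) (z - x) t := by
      refine ((((hasDerivAt_id t).const_sub 1).smul_const x).add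
        ((hasDerivAt_id t).smul_const z)).congr_deriv ?_
      simp [sub_eq_add_neg, add_comm]
    exact (hu _ (hc hx hz (by linarith [ht.2]) ht.1 (by ring))).hasFDerivAt.comp_hasDerivAt t h1
  have hmeas : AEStronglyMeasurable γ' (volume.restrict (Set.Ioc 0 δ)) := by
    refine (stronglyMeasurable_deriv γ).aestronglyMeasurable.congr ?_
    refine (ae_restrict_iff' measurableSet_Ioc).2 (ae_of_all _ fun t ht => ?_)
    exact (hderiv t (by rw [Set.uIcc_of_le hδ]; exact ⟨ht.1.le, ht.2⟩)).deriv
  have hle : ∫⁻ t in Set.Ioc 0 δ, ‖γ' t‖ₑ ≤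
      ‖z - x‖ₑ * ∫⁻ t in Set.Ioc 0 δ, ‖fderiv ℝ u ((1 - t) • x + t • z)‖ₑ := by
    rw [← lintegral_const_mul' _ _ enorm_ne_top]
    refine lintegral_mono fun t => ?_
    rw [mul_comm]
    exact ContinuousLinearMap.le_opENorm _ _
  refine le_trans ?_ (add_le_add_right hle _)
  by_cases htop : ∫⁻ t in Set.Ioc 0 δ, ‖γ' t‖ₑ = ⊤
  · simp [htop]
  have hint : IntegrableOn γ' (Set.Ioc 0 δ) := ⟨hmeas, lt_top_iff_ne_top.2 htop⟩
  have hftc := intervalIntegral.integral_eq_sub_of_hasDerivAt hderiv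
    ((intervalIntegrable_iff_integrableOn_Ioc_of_le hδ).2 hint)
  rw [intervalIntegral.integral_of_le hδ] at hftc
  have h0 : u x = γ δ - ∫ t in Set.Ioc 0 δ, γ' t := by
    rw [hftc]; simp [γ]
  rw [h0]
  exact enorm_sub_le.trans (add_le_add_right (enorm_integral_le_lintegral_enorm _) _)

variable [MeasurableSpace E] [BorelSpace E] {μ : Measure E}

/-- The integral over `z ∈ Ω` of `f` at the point dividing the segment from `x` to `z` in the
ratio `t : 1 - t`. -/
def segmentLIntegral (μ : Measure E) (Ω : Set E) (f : E → ENNReal) (t : ℝ) (x : E) : ENNReal :=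
  ∫⁻ z in Ω, f ((1 - t) • x + t • z) ∂μ

theorem segmentLIntegral_sq_le {f : E → ENNReal} (hf : Measurable f) (t : ℝ) (x : E) :
    segmentLIntegral μ Ω f t x ^ (2 : ℝ) ≤
      μ Ω * ∫⁻ z in Ω, f ((1 - t) • x + t • z) ^ (2 : ℝ) ∂μ := by
  have h := ENNReal.lintegral_mul_le_Lp_mul_Lq (μ.restrict Ω) Real.HolderConjugate.two_two
    (f := fun _ => 1) (g := fun z => f ((1 - t) • x + t • z)) (by fun_prop)
    (hf.comp (by fun_prop)).aemeasurable
  have h2 := ENNReal.rpow_le_rpow h (zero_le_two (α := ℝ))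
  rw [ENNReal.mul_rpow_of_nonneg _ _ zero_le_two, ← ENNReal.rpow_mul, ← ENNReal.rpow_mul] at h2
  simpa [segmentLIntegral] using h2

variable [FiniteDimensional ℝ E] [μ.IsAddHaarMeasure]

theorem measurable_segmentLIntegral {α : Type*} [MeasurableSpace α] {f : E → ENNReal}
    (hf : Measurable f) {t : α → ℝ} {x : α → E} (ht : Measurable t) (hx : Measurable x) :
    Measurable fun a => segmentLIntegral μ Ω f (t a) (x a) := by
  refine Measurable.lintegral_prod_right'
    (f := fun w : α × E => f ((1 - t w.1) • x w.1 + t w.1 • w.2)) ?_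
  exact hf.comp (by fun_prop)

/-- Scaling bound for the integral of `g` along the affine contraction `z ↦ a + s • z`. -/
theorem setLIntegral_comp_affine_le (hΩ : MeasurableSet Ω) {g : E → ENNReal} (hg : Measurable g)
    {s : ℝ} (hs : 0 < s) {a : E} (ha : ∀ z ∈ Ω, a + s • z ∈ Ω) :
    ∫⁻ z in Ω, g (a + s • z) ∂μ ≤
      ENNReal.ofReal ((s ^ Module.finrank ℝ E)⁻¹) * ∫⁻ z in Ω, g z ∂μ := by
  have hgi : Measurable (Ω.indicator g) := hg.indicator hΩ
  calc ∫⁻ z in Ω, g (a + s • z) ∂μ = ∫⁻ z in Ω, Ω.indicator g (a + s • z) ∂μ :=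
        setLIntegral_congr_fun hΩ fun z hz => by rw [Set.indicator_of_mem (ha z hz)]
    _ ≤ ∫⁻ z, Ω.indicator g (a + s • z) ∂μ := setLIntegral_le_lintegral _ _
    _ = ∫⁻ y, Ω.indicator g (a + y) ∂(μ.map (s • ·)) :=
        (lintegral_map (f := fun y => Ω.indicator g (a + y)) (by fun_prop) (by fun_prop)).symm
    _ = _ := by
        rw [Measure.map_addHaar_smul μ hs.ne', lintegral_smul_measure,
          lintegral_add_left_eq_self, lintegral_indicator hΩ, abs_of_pos (by positivity),
          smul_eq_mul]

theorem segmentLIntegral_sq_le_of_mem (hΩ : MeasurableSet Ω) (hc : Convex ℝ Ω)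
    {f : E → ENNReal} (hf : Measurable f) {t : ℝ} (ht : 0 < t) (ht1 : t ≤ 1) {x : E}
    (hx : x ∈ Ω) :
    segmentLIntegral μ Ω f t x ^ (2 : ℝ) ≤
      μ Ω * (ENNReal.ofReal ((t ^ Module.finrank ℝ E)⁻¹) * ∫⁻ z in Ω, f z ^ (2 : ℝ) ∂μ) := by
  refine (segmentLIntegral_sq_le hf t x).trans ?_
  gcongr
  exact setLIntegral_comp_affine_le hΩ (hf.pow_const _) ht
    fun z hz => hc hx hz (by linarith) ht.le (by ring)

theorem setLIntegral_segmentLIntegral_sq_le (hΩ : MeasurableSet Ω) (hc : Convex ℝ Ω)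
    {f : E → ENNReal} (hf : Measurable f) {t : ℝ} (ht : 0 ≤ t) (ht1 : t < 1) :
    ∫⁻ x in Ω, segmentLIntegral μ Ω f t x ^ (2 : ℝ) ∂μ ≤
      μ Ω ^ 2 * (ENNReal.ofReal (((1 - t) ^ Module.finrank ℝ E)⁻¹) *
        ∫⁻ z in Ω, f z ^ (2 : ℝ) ∂μ) := by
  have hm : Measurable (Function.uncurry fun x z : E => f ((1 - t) • x + t • z) ^ (2 : ℝ)) :=
    (hf.comp (by fun_prop)).pow_const _
  calc _ ≤ ∫⁻ x in Ω, μ Ω * ∫⁻ z in Ω, f ((1 - t) • x + t • z) ^ (2 : ℝ) ∂μ ∂μ :=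
        lintegral_mono fun x => segmentLIntegral_sq_le hf t x
    _ = μ Ω * ∫⁻ z in Ω, ∫⁻ x in Ω, f ((1 - t) • x + t • z) ^ (2 : ℝ) ∂μ ∂μ := by
        rw [lintegral_const_mul _ hm.lintegral_prod_right, lintegral_lintegral_swap hm.aemeasurable]
    _ ≤ μ Ω * ∫⁻ z in Ω, (ENNReal.ofReal (((1 - t) ^ Module.finrank ℝ E)⁻¹) *
        ∫⁻ z in Ω, f z ^ (2 : ℝ) ∂μ) ∂μ := by
        gcongr _ * ?_
        refine setLIntegral_mono' hΩ fun z hz => ?_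
        simp_rw [add_comm _ (t • z)]
        refine setLIntegral_comp_affine_le hΩ (hf.pow_const _) (by linarith) fun x hx => ?_
        rw [add_comm]
        exact hc hx hz (by linarith) ht (by ring)
    _ = _ := by rw [setLIntegral_const]; ring

/-- `L² → L^r` bound for `segmentLIntegral`. -/
theorem setLIntegral_segmentLIntegral_rpow_le (hΩ : MeasurableSet Ω) (hc : Convex ℝ Ω)
    {f : E → ENNReal} (hf : Measurable f) {t r : ℝ} (ht : 0 < t) (ht1 : t ≤ 1 / 2)
    (hr : 2 ≤ r) :
    ∫⁻ x in Ω, segmentLIntegral μ Ω f t x ^ r ∂μ ≤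
      2 ^ Module.finrank ℝ E * μ Ω ^ (r / 2 + 1) *
        ENNReal.ofReal (t ^ (-(Module.finrank ℝ E * (r - 2) / 2))) *
        (∫⁻ z in Ω, f z ^ (2 : ℝ) ∂μ) ^ (r / 2) := by
  set I := ∫⁻ z in Ω, f z ^ (2 : ℝ) ∂μ
  set d := Module.finrank ℝ E
  have hm : Measurable fun x => segmentLIntegral μ Ω f t x :=
    measurable_segmentLIntegral hf measurable_const measurable_id
  have hd : ENNReal.ofReal (((1 - t) ^ d)⁻¹) ≤ 2 ^ d := by
    rw [← inv_pow, ENNReal.ofReal_pow (inv_nonneg.2 (by linarith))]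
    gcongr
    refine ENNReal.ofReal_le_of_le_toReal ?_
    simpa using inv_anti₀ (by norm_num) (show (1 / 2 : ℝ) ≤ 1 - t by linarith)
  calc ∫⁻ x in Ω, segmentLIntegral μ Ω f t x ^ r ∂μ
      ≤ ∫⁻ x in Ω, (μ Ω * (ENNReal.ofReal ((t ^ d)⁻¹) * I)) ^ ((r - 2) / 2) *
          segmentLIntegral μ Ω f t x ^ (2 : ℝ) ∂μ := by
        refine setLIntegral_mono' hΩ fun x hx => ?_
        calc segmentLIntegral μ Ω f t x ^ r
            = (segmentLIntegral μ Ω f t x ^ (2 : ℝ)) ^ ((r - 2) / 2) *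
                segmentLIntegral μ Ω f t x ^ (2 : ℝ) := by
              rw [← ENNReal.rpow_mul, ← ENNReal.rpow_add_of_nonneg _ _ (by linarith) zero_le_two]
              congr 1; ring
          _ ≤ _ := by
              refine mul_le_mul' (ENNReal.rpow_le_rpow ?_ (by linarith)) le_rfl
              exact segmentLIntegral_sq_le_of_mem hΩ hc hf ht (by linarith) hx
    _ = (μ Ω * (ENNReal.ofReal ((t ^ d)⁻¹) * I)) ^ ((r - 2) / 2) *
          ∫⁻ x in Ω, segmentLIntegral μ Ω f t x ^ (2 : ℝ) ∂μ :=
        lintegral_const_mul _ (hm.pow_const _)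
    _ ≤ (μ Ω * (ENNReal.ofReal ((t ^ d)⁻¹) * I)) ^ ((r - 2) / 2) * (μ Ω ^ 2 * (2 ^ d * I)) := by
        gcongr
        refine (setLIntegral_segmentLIntegral_sq_le hΩ hc hf ht.le (by linarith)).trans ?_
        gcongr
    _ = _ := by
        have h0 : 0 ≤ (r - 2) / 2 := by linarith
        have hμ : μ Ω ^ (r / 2 + 1) = μ Ω ^ ((r - 2) / 2) * μ Ω ^ 2 := by
          rw [← ENNReal.rpow_natCast, ← ENNReal.rpow_add_of_nonneg _ _ h0 (by norm_num)]
          congr 1; push_cast; ring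
        have hI : I ^ (r / 2) = I ^ ((r - 2) / 2) * I := by
          nth_rw 3 [← ENNReal.rpow_one I]
          rw [← ENNReal.rpow_add_of_nonneg _ _ h0 zero_le_one]
          congr 1; ring
        have ht' : ENNReal.ofReal (t ^ (-(d * (r - 2) / 2))) =
            ENNReal.ofReal ((t ^ d)⁻¹) ^ ((r - 2) / 2) := by
          rw [ENNReal.ofReal_rpow_of_nonneg (by positivity) h0, ← Real.rpow_natCast,
            ← Real.rpow_neg ht.le, ← Real.rpow_mul ht.le]
          congr 2; ring
        rw [hμ, hI, ht', ENNReal.mul_rpow_of_nonneg _ _ h0, ENNReal.mul_rpow_of_nonneg _ _ h0]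
        ring

/-- Hölder pairing of `P` with `segmentLIntegral`. -/
theorem setLIntegral_mul_segmentLIntegral_le (hΩ : MeasurableSet Ω) (hc : Convex ℝ Ω)
    {f P : E → ENNReal} (hf : Measurable f) (hP : AEMeasurable P (μ.restrict Ω)) {t m r : ℝ}
    (ht : 0 < t) (ht1 : t ≤ 1 / 2) (hmr : m.HolderConjugate r) (hr : 2 ≤ r) :
    ∫⁻ x in Ω, P x * segmentLIntegral μ Ω f t x ∂μ ≤
      (∫⁻ x in Ω, P x ^ m ∂μ) ^ (1 / m) *
        ((2 ^ Module.finrank ℝ E * μ Ω ^ (r / 2 + 1)) ^ (1 / r) *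
        ENNReal.ofReal (t ^ (-(Module.finrank ℝ E * (1 / 2 - 1 / r)))) *
        (∫⁻ z in Ω, f z ^ (2 : ℝ) ∂μ) ^ (1 / 2 : ℝ)) := by
  have hm : Measurable fun x => segmentLIntegral μ Ω f t x :=
    measurable_segmentLIntegral hf measurable_const measurable_id
  have hr0 : 0 < r := by linarith
  refine (ENNReal.lintegral_mul_le_Lp_mul_Lq _ hmr hP hm.aemeasurable).trans ?_
  gcongr
  refine (ENNReal.rpow_le_rpow (setLIntegral_segmentLIntegral_rpow_le hΩ hc hf ht ht1 hr)
    (by positivity : 0 ≤ 1 / r)).trans_eq ?_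
  have h0 : 0 ≤ 1 / r := by positivity
  rw [ENNReal.mul_rpow_of_nonneg _ _ h0, ENNReal.mul_rpow_of_nonneg _ _ h0,
    ENNReal.ofReal_rpow_of_nonneg (by positivity) h0, ← Real.rpow_mul ht.le, ← ENNReal.rpow_mul]
  have ht' : -(Module.finrank ℝ E * (r - 2) / 2) * (1 / r) =
      -(Module.finrank ℝ E * (1 / 2 - 1 / r)) := by field_simp
  have hI : r / 2 * (1 / r) = 1 / 2 := by field_simp
  rw [ht', hI]

theorem measure_mul_enorm_le_segmentLIntegral {u : E → F} (hΩ : MeasurableSet Ω)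
    (hc : Convex ℝ Ω) (hu : ∀ x ∈ Ω, DifferentiableAt ℝ u x) {v : E → ENNReal}
    (hv : Measurable v) (huv : ∀ x ∈ Ω, ‖u x‖ₑ = v x) {D : ENNReal}
    (hD : ∀ x ∈ Ω, ∀ z ∈ Ω, ‖z - x‖ₑ ≤ D) {δ : ℝ} (hδ : 0 ≤ δ) (hδ1 : δ ≤ 1) {x : E}
    (hx : x ∈ Ω) :
    μ Ω * ‖u x‖ₑ ≤ segmentLIntegral μ Ω v δ x +
      D * ∫⁻ t in Set.Ioc 0 δ, segmentLIntegral μ Ω (fun y => ‖fderiv ℝ u y‖ₑ) t x := by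
  have hf : Measurable fun y => ‖fderiv ℝ u y‖ₑ := (measurable_fderiv ℝ u).enorm
  have hm : Measurable (Function.uncurry fun (z : E) (t : ℝ) =>
      ‖fderiv ℝ u ((1 - t) • x + t • z)‖ₑ) := hf.comp (by fun_prop)
  calc μ Ω * ‖u x‖ₑ = ∫⁻ _ in Ω, ‖u x‖ₑ ∂μ := by rw [setLIntegral_const, mul_comm]
    _ ≤ ∫⁻ z in Ω, (v ((1 - δ) • x + δ • z) +
          D * ∫⁻ t in Set.Ioc 0 δ, ‖fderiv ℝ u ((1 - t) • x + t • z)‖ₑ) ∂μ := by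
        refine setLIntegral_mono' hΩ fun z hz => ?_
        rw [← huv _ (hc hx hz (by linarith) hδ (by ring))]
        refine (enorm_le_add_lintegral_segment hc hu hx hz hδ hδ1).trans ?_
        gcongr
        exact hD x hx z hz
    _ = _ := by
        have hvm : Measurable fun z => v ((1 - δ) • x + δ • z) := hv.comp (by fun_prop)
        rw [lintegral_add_left hvm,
          lintegral_const_mul _ hm.lintegral_prod_right, lintegral_lintegral_swap hm.aemeasurable]
        rfl

theorem setLIntegral_ofReal_rpow_neg {κ δ : ℝ} (hκ : κ < 1) (hδ : 0 ≤ δ) :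
    ∫⁻ t in Set.Ioc 0 δ, ENNReal.ofReal (t ^ (-κ)) = ENNReal.ofReal (δ ^ (1 - κ) / (1 - κ)) := by
  have hi := intervalIntegral.intervalIntegrable_rpow' (a := 0) (b := δ) (r := -κ) (by linarith)
  rw [← ofReal_integral_eq_lintegral_ofReal
      ((intervalIntegrable_iff_integrableOn_Ioc_of_le hδ).1 hi)
      ((ae_restrict_iff' measurableSet_Ioc).2 (ae_of_all _ fun t ht => rpow_nonneg ht.1.le _)),
    ← intervalIntegral.integral_of_le hδ, integral_rpow (Or.inl (by linarith)),
    Real.zero_rpow (by linarith)]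
  congr 1
  rw [sub_zero, neg_add_eq_sub]

/-- Interpolation estimate on a convex set, with a free scale `δ`. -/
theorem measure_mul_setLIntegral_mul_enorm_le {u : E → F} (hΩ : MeasurableSet Ω)
    (hc : Convex ℝ Ω) (hu : ∀ x ∈ Ω, DifferentiableAt ℝ u x) {P : E → ENNReal}
    (hP : AEMeasurable P (μ.restrict Ω)) {D : ENNReal} (hD : ∀ x ∈ Ω, ∀ z ∈ Ω, ‖z - x‖ₑ ≤ D)
    {m r : ℝ} (hmr : m.HolderConjugate r) (hr : 2 ≤ r)
    (hκ : Module.finrank ℝ E * (1 / 2 - 1 / r) < 1) {δ : ℝ} (hδ : 0 < δ) (hδ1 : δ ≤ 1 / 2) :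
    μ Ω * ∫⁻ x in Ω, P x * ‖u x‖ₑ ∂μ ≤
      (∫⁻ x in Ω, P x ^ m ∂μ) ^ (1 / m) *
        (2 ^ Module.finrank ℝ E * μ Ω ^ (r / 2 + 1)) ^ (1 / r) *
        (ENNReal.ofReal (δ ^ (-(Module.finrank ℝ E * (1 / 2 - 1 / r)))) *
          (∫⁻ x in Ω, ‖u x‖ₑ ^ (2 : ℝ) ∂μ) ^ (1 / 2 : ℝ) +
        D * ENNReal.ofReal (δ ^ (1 - Module.finrank ℝ E * (1 / 2 - 1 / r)) /
            (1 - Module.finrank ℝ E * (1 / 2 - 1 / r))) *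
          (∫⁻ x in Ω, ‖fderiv ℝ u x‖ₑ ^ (2 : ℝ) ∂μ) ^ (1 / 2 : ℝ)) := by
  set κ : ℝ := Module.finrank ℝ E * (1 / 2 - 1 / r)
  set Q := (∫⁻ x in Ω, P x ^ m ∂μ) ^ (1 / m)
  set K := (2 ^ Module.finrank ℝ E * μ Ω ^ (r / 2 + 1)) ^ (1 / r)
  let f : E → ENNReal := fun y => ‖fderiv ℝ u y‖ₑ
  let v : E → ENNReal := Ω.indicator fun y => ‖u y‖ₑ
  have hf : Measurable f := (measurable_fderiv ℝ u).enorm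
  have hv : Measurable v := by
    classical
    have hcont : ContinuousOn (fun y => ‖u y‖ₑ) Ω :=
      continuous_enorm.comp_continuousOn fun x hx => (hu x hx).continuousAt.continuousWithinAt
    rw [show v = Ω.piecewise (fun y => ‖u y‖ₑ) 0 from Set.piecewise_eq_indicator.symm]
    exact hcont.measurable_piecewise continuousOn_const hΩ
  have huv : ∀ x ∈ Ω, ‖u x‖ₑ = v x := fun x hx => (Set.indicator_of_mem hx (fun y => ‖u y‖ₑ)).symm
  have hX : ∫⁻ x in Ω, ‖u x‖ₑ ^ (2 : ℝ) ∂μ = ∫⁻ x in Ω, v x ^ (2 : ℝ) ∂μ :=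
    setLIntegral_congr_fun hΩ fun x hx => by rw [huv x hx]
  have hms : Measurable fun y : E × ℝ => segmentLIntegral μ Ω f y.2 y.1 :=
    measurable_segmentLIntegral hf measurable_snd measurable_fst
  have hmP : AEMeasurable (Function.uncurry fun (x : E) (t : ℝ) =>
      P x * segmentLIntegral μ Ω f t x) ((μ.restrict Ω).prod (volume.restrict (Set.Ioc 0 δ))) :=
    hP.comp_fst.mul hms.aemeasurable
  have hmv : AEMeasurable (fun x => P x * segmentLIntegral μ Ω v δ x) (μ.restrict Ω) :=
    hP.mul (measurable_segmentLIntegral hv measurable_const measurable_id).aemeasurable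
  calc μ Ω * ∫⁻ x in Ω, P x * ‖u x‖ₑ ∂μ ≤ ∫⁻ x in Ω, μ Ω * (P x * ‖u x‖ₑ) ∂μ :=
        lintegral_const_mul_le _ _
    _ ≤ ∫⁻ x in Ω, (P x * segmentLIntegral μ Ω v δ x +
          D * ∫⁻ t in Set.Ioc 0 δ, P x * segmentLIntegral μ Ω f t x) ∂μ := by
        refine setLIntegral_mono' hΩ fun x hx => ?_
        have hmx : Measurable fun t => segmentLIntegral μ Ω f t x :=
          measurable_segmentLIntegral hf measurable_id measurable_const
        rw [lintegral_const_mul _ hmx, mul_left_comm, mul_left_comm D, ← mul_add]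
        gcongr
        exact measure_mul_enorm_le_segmentLIntegral hΩ hc hu hv huv hD hδ.le (by linarith) hx
    _ = ∫⁻ x in Ω, P x * segmentLIntegral μ Ω v δ x ∂μ +
          D * ∫⁻ t in Set.Ioc 0 δ, ∫⁻ x in Ω, P x * segmentLIntegral μ Ω f t x ∂μ := by
        have hmi : AEMeasurable
            (fun x => ∫⁻ t in Set.Ioc 0 δ, P x * segmentLIntegral μ Ω f t x) (μ.restrict Ω) :=
          hmP.lintegral_prod_right'
        rw [lintegral_add_left' hmv, lintegral_const_mul'' _ hmi, lintegral_lintegral_swap hmP]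
    _ ≤ Q * (K * ENNReal.ofReal (δ ^ (-κ)) * (∫⁻ x in Ω, v x ^ (2 : ℝ) ∂μ) ^ (1 / 2 : ℝ)) +
          D * ∫⁻ t in Set.Ioc 0 δ, Q * (K * ENNReal.ofReal (t ^ (-κ)) *
            (∫⁻ x in Ω, f x ^ (2 : ℝ) ∂μ) ^ (1 / 2 : ℝ)) := by
        gcongr ?_ + D * ?_
        · exact setLIntegral_mul_segmentLIntegral_le hΩ hc hv hP hδ hδ1 hmr hr
        · exact setLIntegral_mono' measurableSet_Ioc fun t ht =>
            setLIntegral_mul_segmentLIntegral_le hΩ hc hf hP ht.1 (ht.2.trans hδ1) hmr hr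
    _ = _ := by
        have hmt : Measurable fun t : ℝ => ENNReal.ofReal (t ^ (-κ)) := by fun_prop
        rw [lintegral_const_mul _ ((hmt.const_mul _).mul_const _),
          lintegral_mul_const _ (hmt.const_mul _), lintegral_const_mul _ hmt,
          setLIntegral_ofReal_rpow_neg hκ hδ.le, hX]
        ring

end SegmentIntegral

theorem norm_fderiv_sq_le_gradNormSq (u : E5 → E5) (x : E5) :
    ‖fderiv ℝ u x‖ ^ 2 ≤ gradNormSq u x := by
  have h0 : 0 ≤ gradNormSq u x := Finset.sum_nonneg fun _ _ => sq_nonneg _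
  suffices ‖fderiv ℝ u x‖ ≤ √(gradNormSq u x) from (Real.le_sqrt (norm_nonneg _) h0).1 this
  refine ContinuousLinearMap.opNorm_le_bound _ (Real.sqrt_nonneg _) fun y => ?_
  have hy : y = ∑ i, y i • eb i := by
    ext j
    simp [eb, Pi.single_apply]
  calc ‖fderiv ℝ u x y‖ = ‖∑ i, y i • fderiv ℝ u x (eb i)‖ := by
        conv_lhs => rw [hy]
        simp only [map_sum, map_smul]
    _ ≤ ∑ i, ‖fderiv ℝ u x (eb i)‖ * ‖y i‖ :=
        norm_sum_le_of_le _ fun i _ => by rw [norm_smul, mul_comm]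
    _ ≤ √(∑ i, ‖fderiv ℝ u x (eb i)‖ ^ 2) * √(∑ i, ‖y i‖ ^ 2) :=
        Real.sum_mul_le_sqrt_mul_sqrt _ _ _
    _ = √(gradNormSq u x) * ‖y‖ := by rw [EuclideanSpace.norm_eq]; rfl

/-- Optimisation over the free scale `δ`. -/
theorem le_of_forall_scale {S C X Y κ : ℝ} (hC : 0 ≤ C) (hX : 0 ≤ X) (hY : 0 ≤ Y)
    (hκ1 : κ < 1)
    (h : ∀ δ : ℝ, 0 < δ → δ ≤ 1 / 2 → S ≤ C * (δ ^ (-κ) * X + δ ^ (1 - κ) * Y)) :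
    S ≤ 4 * C * (X ^ (1 - κ) * Y ^ κ + X) := by
  suffices hδ : S ≤ C * (4 * (X ^ (1 - κ) * Y ^ κ + X)) by linarith
  have hXY : 0 ≤ X ^ (1 - κ) * Y ^ κ := by positivity
  rcases le_or_gt Y (2 * X) with hle | hlt
  · refine (h (1 / 2) (by norm_num) le_rfl).trans (mul_le_mul_of_nonneg_left ?_ hC)
    have h1 : (1 / 2 : ℝ) ^ (-κ) ≤ 2 := by
      rw [one_div, Real.inv_rpow zero_le_two, Real.rpow_neg zero_le_two, inv_inv]
      exact (Real.rpow_le_rpow_of_exponent_le one_le_two hκ1.le).trans_eq (Real.rpow_one 2)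
    have h2 : (1 / 2 : ℝ) ^ (1 - κ) ≤ 1 :=
      Real.rpow_le_one (by norm_num) (by norm_num) (by linarith)
    nlinarith [mul_le_mul_of_nonneg_right h1 hX, mul_le_mul_of_nonneg_right h2 hY]
  · have hY0 : 0 < Y := by linarith
    rcases hX.eq_or_lt with rfl | hX0
    · have hlim : Filter.Tendsto (fun δ : ℝ => C * (δ ^ (1 - κ) * Y)) (nhdsWithin 0 (Set.Ioi 0))
          (nhds 0) := by
        have := (Real.continuousAt_rpow_const 0 (1 - κ) (Or.inr (by linarith))).tendsto
        rw [Real.zero_rpow (by linarith)] at this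
        simpa using ((this.mono_left nhdsWithin_le_nhds).mul_const Y).const_mul C
      have hS : S ≤ 0 := by
        refine ge_of_tendsto hlim ?_
        filter_upwards [Ioc_mem_nhdsGT (show (0 : ℝ) < 1 / 2 by norm_num)] with δ hδ
        simpa using h δ hδ.1 hδ.2
      exact hS.trans (by positivity)
    · refine (h (X / Y) (by positivity) ?_).trans (mul_le_mul_of_nonneg_left ?_ hC)
      · rw [div_le_iff₀ hY0]; linarith
      have h1 : (X / Y) ^ (-κ) * X = X ^ (1 - κ) * Y ^ κ := by
        rw [Real.div_rpow hX hY, Real.rpow_sub hX0, Real.rpow_neg hX, Real.rpow_neg hY,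
          Real.rpow_one]
        field_simp
      have h2 : (X / Y) ^ (1 - κ) * Y = X ^ (1 - κ) * Y ^ κ := by
        rw [Real.div_rpow hX hY, Real.rpow_sub hY0, Real.rpow_one]
        field_simp
      rw [h1, h2]
      linarith

/-- Estimate of `∫ P |u|` over a ball, with a free scale `δ`. -/
theorem setIntegral_ball_mul_norm_le {ρ : ℝ} (hρ : 0 < ρ) {u : E5 → E5} {P : E5 → ℝ}
    (hu : ∀ x ∈ ball (0 : E5) ρ, DifferentiableAt ℝ u x)
    (hu2 : IntegrableOn (fun x => ‖u x‖ ^ 2) (ball (0 : E5) ρ))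
    (hgrad : IntegrableOn (gradNormSq u) (ball (0 : E5) ρ))
    (hP : AEStronglyMeasurable P (volume.restrict (ball (0 : E5) ρ))) (hP0 : ∀ x, 0 ≤ P x)
    {m r : ℝ} (hPm : IntegrableOn (fun x => P x ^ m) (ball (0 : E5) ρ))
    (hmr : m.HolderConjugate r) (hr : 2 ≤ r) (hκ : 5 * (1 / 2 - 1 / r) < 1)
    {δ : ℝ} (hδ : 0 < δ) (hδ1 : δ ≤ 1 / 2) :
    volume.real (ball (0 : E5) ρ) * ∫ x in ball (0 : E5) ρ, P x * ‖u x‖ ≤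
      (∫ x in ball (0 : E5) ρ, P x ^ m) ^ (1 / m) *
        (2 ^ 5 * volume.real (ball (0 : E5) ρ) ^ (r / 2 + 1)) ^ (1 / r) *
        (δ ^ (-(5 * (1 / 2 - 1 / r))) * (∫ x in ball (0 : E5) ρ, ‖u x‖ ^ 2) ^ (1 / 2 : ℝ) +
          2 * ρ * (δ ^ (1 - 5 * (1 / 2 - 1 / r)) / (1 - 5 * (1 / 2 - 1 / r))) *
            (∫ x in ball (0 : E5) ρ, gradNormSq u x) ^ (1 / 2 : ℝ)) := by
  set B := ball (0 : E5) ρ with hB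
  have hd : Module.finrank ℝ E5 = 5 := by simp
  have hm0 : 0 < m := hmr.pos
  have hg0 : ∀ x, 0 ≤ gradNormSq u x := fun x => Finset.sum_nonneg fun _ _ => sq_nonneg _
  have hucont : ContinuousOn u B := fun x hx => (hu x hx).continuousAt.continuousWithinAt
  have hV : volume B = ENNReal.ofReal (volume.real B) :=
    (ENNReal.ofReal_toReal measure_ball_lt_top.ne).symm
  have hdiam : ∀ x ∈ B, ∀ z ∈ B, ‖z - x‖ₑ ≤ ENNReal.ofReal (2 * ρ) := by
    intro x hx z hz
    rw [← ofReal_norm]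
    refine ENNReal.ofReal_le_ofReal ((norm_sub_le z x).trans ?_)
    rw [hB, mem_ball_zero_iff] at hx hz
    linarith
  have hlP : ∫⁻ x in B, ENNReal.ofReal (P x) ^ m = ENNReal.ofReal (∫ x in B, P x ^ m) := by
    rw [ofReal_integral_eq_lintegral_ofReal hPm (ae_of_all _ fun x => rpow_nonneg (hP0 x) _)]
    simp_rw [ENNReal.ofReal_rpow_of_nonneg (hP0 _) hm0.le]
  have hlu : ∫⁻ x in B, ‖u x‖ₑ ^ (2 : ℝ) = ENNReal.ofReal (∫ x in B, ‖u x‖ ^ 2) := by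
    rw [ofReal_integral_eq_lintegral_ofReal hu2 (ae_of_all _ fun x => sq_nonneg _)]
    simp_rw [ENNReal.ofReal_pow (norm_nonneg _), ofReal_norm, ENNReal.rpow_ofNat]
  have hlg : ∫⁻ x in B, ‖fderiv ℝ u x‖ₑ ^ (2 : ℝ) ≤
      ENNReal.ofReal (∫ x in B, gradNormSq u x) := by
    rw [ofReal_integral_eq_lintegral_ofReal hgrad (ae_of_all _ hg0)]
    refine lintegral_mono fun x => ?_
    rw [ENNReal.rpow_ofNat, ← ofReal_norm, ← ENNReal.ofReal_pow (norm_nonneg _)]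
    exact ENNReal.ofReal_le_ofReal (norm_fderiv_sq_le_gradNormSq u x)
  have hlS : ∫ x in B, P x * ‖u x‖ = (∫⁻ x in B, ENNReal.ofReal (P x) * ‖u x‖ₑ).toReal := by
    rw [integral_eq_lintegral_of_nonneg_ae
      (ae_of_all _ fun x => mul_nonneg (hP0 x) (norm_nonneg _))
      (hP.mul (hucont.aestronglyMeasurable measurableSet_ball).norm)]
    simp_rw [ENNReal.ofReal_mul (hP0 _), ofReal_norm]
  have key := measure_mul_setLIntegral_mul_enorm_le (μ := volume) measurableSet_ball
    (convex_ball (0 : E5) ρ) hu hP.aemeasurable.ennreal_ofReal hdiam hmr hr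
    (by rw [hd]; exact_mod_cast hκ) hδ hδ1
  rw [hd, Nat.cast_ofNat, ← hB, hlP, hlu, hV] at key
  have hκ' : 0 < 1 - 5 * (1 / 2 - 1 / r) := by linarith
  have hr0 : 0 ≤ 1 / r := by positivity
  have hm0' : 0 ≤ 1 / m := by positivity
  have hI : 0 ≤ ∫ x in B, P x ^ m := integral_nonneg fun x => rpow_nonneg (hP0 x) _
  have hX : 0 ≤ ∫ x in B, ‖u x‖ ^ 2 := integral_nonneg fun x => sq_nonneg _
  have hY : 0 ≤ ∫ x in B, gradNormSq u x := integral_nonneg hg0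
  have hv0 : 0 ≤ volume.real B := measureReal_nonneg
  rw [hlS, ← ENNReal.toReal_ofReal hv0, ← ENNReal.toReal_mul]
  refine ENNReal.toReal_le_of_le_ofReal (by positivity) (key.trans ?_)
  rw [ENNReal.toReal_ofReal hv0, ENNReal.ofReal_mul (by positivity),
    ENNReal.ofReal_mul (by positivity),
    ENNReal.ofReal_add (by positivity) (by positivity), ENNReal.ofReal_mul (by positivity),
    ENNReal.ofReal_mul (by positivity),
    ENNReal.ofReal_mul (p := 2 * ρ * _) (by positivity),
    ← ENNReal.ofReal_rpow_of_nonneg hI hm0', ← ENNReal.ofReal_rpow_of_nonneg hX (by norm_num),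
    ← ENNReal.ofReal_rpow_of_nonneg hY (by norm_num),
    ← ENNReal.ofReal_rpow_of_nonneg (by positivity) hr0, ENNReal.ofReal_mul (by positivity),
    ← ENNReal.ofReal_rpow_of_nonneg hv0 (by positivity)]
  gcongr
  · simp
  · rw [← ENNReal.ofReal_mul zero_le_two, ← ENNReal.ofReal_mul (by positivity)]

/-- **Pressure–velocity interpolation estimate.** For `u ∈ H¹(B_ρ;ℝ⁵)` and
`p ∈ L^{5(1+c)/(4−c)}(B_ρ)`,
`∫_{B_ρ}|p − (p)_{B_ρ}||u| ≤ N ρ² (A^{(9c−1)/(4(1+c))} E^{(3−7c)/(4(1+c))} G^{(4−c)/(5(1+c))}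
+ A^{1/2} G^{(4−c)/(5(1+c))})` with `N = N(c)`. -/
theorem pressure_velocity_interpolation (q c : ℝ) (hq1 : 5 / 2 < q) (hq2 : q < 10 / 3)
    (hc1 : (5 - q) / (6 * q - 5) < c) (hc2 : c < 1 / 4) :
    ∃ N > (0 : ℝ), ∀ ρ : ℝ, 0 < ρ → ∀ (u : E5 → E5) (p : E5 → ℝ),
      (∀ x ∈ ball (0 : E5) ρ, DifferentiableAt ℝ u x) →
      IntegrableOn (fun x => ‖u x‖ ^ 2) (ball (0 : E5) ρ) →
      IntegrableOn (gradNormSq u) (ball (0 : E5) ρ) →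
      IntegrableOn p (ball (0 : E5) ρ) →
      IntegrableOn (fun x => |p x| ^ (5 * (1 + c) / (4 - c))) (ball (0 : E5) ρ) →
      (∫ x in ball (0 : E5) ρ, |p x - avgOn (ball (0 : E5) ρ) p| * ‖u x‖) ≤
        N * ρ ^ 2 *
          (qA u 0 ρ ^ ((9 * c - 1) / (4 * (1 + c))) * qE u 0 ρ ^ ((3 - 7 * c) / (4 * (1 + c)))
              * qG p c 0 ρ ^ ((4 - c) / (5 * (1 + c)))
            + qA u 0 ρ ^ ((1 : ℝ) / 2) * qG p c 0 ρ ^ ((4 - c) / (5 * (1 + c)))) := by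
  have hc : 1 / 9 < c := by
    refine lt_of_le_of_lt ?_ hc1
    rw [div_le_div_iff₀ (by norm_num) (by linarith)]
    linarith
  set m : ℝ := 5 * (1 + c) / (4 - c) with hm
  set r : ℝ := 5 * (1 + c) / (1 + 6 * c) with hr
  set κ : ℝ := (3 - 7 * c) / (2 * (1 + c)) with hκ
  have hc1' : 0 < 1 + c := by linarith
  have hc4 : 0 < 4 - c := by linarith
  have hc6 : 0 < 1 + 6 * c := by linarith
  have hm0 : 0 < m := by positivity
  have hr0 : 0 < r := by positivity
  have hmr : m.HolderConjugate r := by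
    refine ⟨?_, hm0, hr0⟩
    rw [hm, hr]; field_simp; ring
  have hm1 : 1 / m = (4 - c) / (5 * (1 + c)) := one_div_div _ _
  have hr2 : 2 ≤ r := by rw [hr, le_div_iff₀ hc6]; linarith
  have hκr : 5 * (1 / 2 - 1 / r) = κ := by rw [hr, hκ]; field_simp; ring
  have hκ0 : 0 ≤ κ := div_nonneg (by linarith) (by linarith)
  have hκ1 : κ < 1 := by rw [hκ, div_lt_one (by linarith)]; linarith
  have h1κ : 0 < 1 - κ := by linarith
  set ω : ℝ := volume.real (ball (0 : E5) 1)
  have hω : 0 < ω := ENNReal.toReal_pos (measure_ball_pos _ _ one_pos).ne' measure_ball_lt_top.ne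
  refine ⟨4 * ((2 ^ 5) ^ (1 / r) * ω ^ (1 / r - 1 / 2) * (2 / (1 - κ))), by positivity, ?_⟩
  intro ρ hρ u p hu hu2 hgrad hp hpm
  set B := ball (0 : E5) ρ with hB
  set a := ∫ x in B, ‖u x‖ ^ 2 with ha
  set b := ∫ x in B, gradNormSq u x with hb
  set w := ∫ x in B, |p x - avgOn B p| ^ m with hw
  have ha0 : 0 ≤ a := integral_nonneg fun x => sq_nonneg _
  have hb0 : 0 ≤ b := integral_nonneg fun x => Finset.sum_nonneg fun _ _ => sq_nonneg _
  have hw0 : 0 ≤ w := integral_nonneg fun x => rpow_nonneg (abs_nonneg _) _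
  have hV : volume.real B = ρ ^ 5 * ω := by
    rw [measureReal_def, hB, Measure.addHaar_ball _ _ hρ.le, ENNReal.toReal_mul,
      ENNReal.toReal_ofReal (by positivity), finrank_euclideanSpace_fin]
    rfl
  have : IsFiniteMeasure (volume.restrict B) := isFiniteMeasure_restrict.2 measure_ball_lt_top.ne
  have hPm : IntegrableOn (fun x => |p x - avgOn B p| ^ m) B := by
    have hm' : ENNReal.ofReal m ≠ 0 := by simpa using hm0
    have hmem : MemLp p (ENNReal.ofReal m) (volume.restrict B) := by
      rw [← integrable_norm_rpow_iff hp.aestronglyMeasurable hm' ENNReal.ofReal_ne_top,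
        ENNReal.toReal_ofReal hm0.le]
      exact hpm
    have := (hmem.sub (memLp_const (avgOn B p))).integrable_norm_rpow hm' ENNReal.ofReal_ne_top
    rw [ENNReal.toReal_ofReal hm0.le] at this
    exact this
  have hPs : AEStronglyMeasurable (fun x => |p x - avgOn B p|) (volume.restrict B) :=
    (hp.aestronglyMeasurable.sub aestronglyMeasurable_const).norm
  have hest := fun δ (hδ : 0 < δ) (hδ1 : δ ≤ 1 / 2) =>
    setIntegral_ball_mul_norm_le hρ hu hu2 hgrad hPs (fun x => abs_nonneg _) hPm hmr hr2
      (by rwa [hκr]) hδ hδ1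
  simp only [hκr, ← hB, ← ha, ← hb, ← hw] at hest
  set S := ∫ x in B, |p x - avgOn B p| * ‖u x‖
  set V := volume.real B
  have hV0 : 0 < V := by rw [hV]; positivity
  have hscale := le_of_forall_scale (S := S) (X := a ^ (1 / 2 : ℝ)) (Y := ρ * b ^ (1 / 2 : ℝ))
    (C := w ^ (1 / m) * ((2 ^ 5) ^ (1 / r) * V ^ (1 / r - 1 / 2)) * (2 / (1 - κ)))
    (by positivity) (by positivity) (by positivity) hκ1 fun δ hδ hδ1 => by
      have hK : (2 ^ 5 * V ^ (r / 2 + 1)) ^ (1 / r) =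
          (2 ^ 5) ^ (1 / r) * V ^ (1 / r - 1 / 2) * V := by
        rw [Real.mul_rpow (by norm_num) (by positivity), ← Real.rpow_mul hV0.le, mul_assoc]
        nth_rw 3 [← Real.rpow_one V]
        rw [← Real.rpow_add hV0]
        congr 2; field_simp; ring
      refine le_of_mul_le_mul_left ((hest δ hδ hδ1).trans ?_) hV0
      rw [hK]
      have h2 : 1 ≤ 2 / (1 - κ) := by rw [le_div_iff₀ h1κ]; linarith
      have hx : δ ^ (-κ) * a ^ (1 / 2 : ℝ) + 2 * ρ * (δ ^ (1 - κ) / (1 - κ)) * b ^ (1 / 2 : ℝ) ≤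
          2 / (1 - κ) *
            (δ ^ (-κ) * a ^ (1 / 2 : ℝ) + δ ^ (1 - κ) * (ρ * b ^ (1 / 2 : ℝ))) := by
        have h3 : 0 ≤ δ ^ (-κ) * a ^ (1 / 2 : ℝ) := by positivity
        calc _ ≤ 2 / (1 - κ) * (δ ^ (-κ) * a ^ (1 / 2 : ℝ)) +
              2 * ρ * (δ ^ (1 - κ) / (1 - κ)) * b ^ (1 / 2 : ℝ) := by
              exact add_le_add_left (le_mul_of_one_le_left h3 h2) _
          _ = _ := by ring
      calc _ ≤ w ^ (1 / m) * ((2 ^ 5) ^ (1 / r) * V ^ (1 / r - 1 / 2) * V) * (2 / (1 - κ) *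
            (δ ^ (-κ) * a ^ (1 / 2 : ℝ) + δ ^ (1 - κ) * (ρ * b ^ (1 / 2 : ℝ)))) := by gcongr
        _ = _ := by ring
  refine hscale.trans_eq ?_
  have hVr : V ^ (1 / r - 1 / 2) = ω ^ (1 / r - 1 / 2) * ρ ^ (-κ) := by
    rw [hV, Real.mul_rpow (by positivity) hω.le, ← Real.rpow_natCast, ← Real.rpow_mul hρ.le,
      mul_comm]
    congr 2
    rw [← hκr]; push_cast; ring
  have he1 : (9 * c - 1) / (4 * (1 + c)) = (1 - κ) / 2 := by rw [hκ]; field_simp; ring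
  have he2 : (3 - 7 * c) / (4 * (1 + c)) = κ / 2 := by rw [hκ]; field_simp; ring
  have hA : ∀ s : ℝ, qA u 0 ρ ^ s = a ^ s * ρ ^ (-(3 * s)) := fun s => by
    rw [qA, Real.div_rpow ha0 (by positivity), ← Real.rpow_natCast, ← Real.rpow_mul hρ.le,
      Real.rpow_neg hρ.le, div_eq_mul_inv]
    norm_cast
  have hE : ∀ s : ℝ, qE u 0 ρ ^ s = b ^ s * ρ ^ (-s) := fun s => by
    rw [qE, Real.div_rpow hb0 hρ.le, Real.rpow_neg hρ.le, div_eq_mul_inv]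
  have hG : qG p c 0 ρ ^ (1 / m) = w ^ (1 / m) * ρ ^ (-((2 - 3 * c) / (1 + c))) := by
    rw [qG, Real.div_rpow hw0 (by positivity), ← Real.rpow_mul hρ.le, Real.rpow_neg hρ.le,
      div_eq_mul_inv]
    congr 3
    rw [hm]; field_simp; ring
  rw [hVr, ← hm1, he1, he2, hA, hA, hE, hG, ← Real.rpow_mul ha0,
    Real.mul_rpow hρ.le (by positivity), ← Real.rpow_mul hb0, ← Real.rpow_natCast ρ 2]
  have hρ1 : ρ ^ (-κ) * ρ ^ κ = 1 := by rw [← Real.rpow_add hρ]; simp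
  have hρ2 : ρ ^ ((2 : ℕ) : ℝ) * ρ ^ (-(3 * ((1 - κ) / 2))) * ρ ^ (-(κ / 2)) *
      ρ ^ (-((2 - 3 * c) / (1 + c))) = 1 := by
    rw [← Real.rpow_add hρ, ← Real.rpow_add hρ, ← Real.rpow_add hρ]
    convert Real.rpow_zero ρ using 2
    rw [hκ]; push_cast; field_simp; ring
  have hρ3 : ρ ^ ((2 : ℕ) : ℝ) * ρ ^ (-(3 * ((1 : ℝ) / 2))) * ρ ^ (-((2 - 3 * c) / (1 + c))) =
      ρ ^ (-κ) := by
    rw [← Real.rpow_add hρ, ← Real.rpow_add hρ]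
    congr 1
    rw [hκ]; push_cast; field_simp; ring
  rw [one_div_mul_eq_div, one_div_mul_eq_div]
  linear_combination (4 * ((2 ^ 5) ^ (1 / r) * ω ^ (1 / r - 1 / 2) * (2 / (1 - κ))) *
    w ^ (1 / m)) * (a ^ ((1 - κ) / 2) * b ^ (κ / 2) * (hρ1 - hρ2) - a ^ (1 / 2 : ℝ) * hρ3)
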